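/- Fix τ≥1, r₀,t₀>0, A₀≥1. There exist ρ>0 depending only on r₀, t₀, τ, and A'≥1 depending only on A₀ and τ, such that: whenever W is a (τt,t₀)-undistorted domain of τ-Lipschitz type in a length space (X,d) for which the closure of the r₀-neighborhood B_{r₀}(W,X) in X is complete and X carries a Borel measure μ that is (r₀,A₀)-doubling along W, the space (W,d_W) with the restriction of μ is (ρ,A')-locally doubling: for every x∈W and every 0<r≤ρ, 0<μ(B_r(x))≤A'·μ(B_{r/2}(x))<∞, balls taken in the induced length metric d_W. -/

import Mathlib

open Set Metric Filter MeasureTheory ENNReal NNReal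

noncomputable section

/-- The infimum of lengths (total variations) of continuous paths from `x` to `y`
with image contained in `S`: the induced length (extended) distance on `S`. -/
def lengthEDistIn {X : Type*} [PseudoEMetricSpace X] (S : Set X) (x y : X) : ℝ≥0∞ :=
  ⨅ (γ : ℝ → X) (_ : ContinuousOn γ (Set.Icc 0 1)) (_ : γ 0 = x) (_ : γ 1 = y)
    (_ : Set.MapsTo γ (Set.Icc 0 1) S), eVariationOn γ (Set.Icc 0 1)

/-- A metric space is a length space if the distance between any two points is the
infimum of lengths of continuous paths joining them. -/
def IsLengthSpace (X : Type*) [MetricSpace X] : Prop :=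
  ∀ x y : X, edist x y = lengthEDistIn (Set.univ : Set X) x y

/-- `(ρ, A₀)`-locally doubling Borel measure. -/
def LocallyDoubling {X : Type*} [MetricSpace X] [MeasurableSpace X]
    (μ : Measure X) (ρ : ℝ) (A₀ : ℝ≥0) : Prop :=
  ∀ (x : X) (r : ℝ), 0 < r → r ≤ ρ →
    0 < μ (Metric.ball x r) ∧
    μ (Metric.ball x r) ≤ (A₀ : ℝ≥0∞) * μ (Metric.ball x (r / 2)) ∧
    (A₀ : ℝ≥0∞) * μ (Metric.ball x (r / 2)) < ⊤

/-- A sequence is Cauchy with respect to the induced length metric of `S`. -/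
def IsCauchyIn {X : Type*} [MetricSpace X] (S : Set X) (u : ℕ → X) : Prop :=
  ∀ ε : ℝ≥0∞, 0 < ε → ∃ N : ℕ, ∀ m ≥ N, ∀ n ≥ N, lengthEDistIn S (u m) (u n) < ε

/-- A sequence converges to `w` with respect to the induced length metric of `S`. -/
def ConvergesIn {X : Type*} [MetricSpace X] (S : Set X) (u : ℕ → X) (w : X) : Prop :=
  Filter.Tendsto (fun n => lengthEDistIn S (u n) w) Filter.atTop (nhds 0)

/-- The `t`-interior `W_t° = {x ∈ W : d_W(x, ∂W) > t}` of `W`, where `∂W` is the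
boundary of the topological interior `W°` in the metric completion of `(W, d_W)`,
expressed without forming the completion: `x ∈ W_t°` iff for some `r > t`, every
point of the completion at `d_W`-distance `< r` from `x` (i.e. every `d_W`-Cauchy
sequence in `W` eventually staying within `d_W`-distance `< r` of `x`) is the image of
a point of the interior `W°`. -/
def IntrinsicInterior {X : Type*} [MetricSpace X] (W : Set X) (t : ℝ) : Set X :=
  {x ∈ W | ∃ r : ℝ, t < r ∧ ∀ u : ℕ → X, (∀ n, u n ∈ W) → IsCauchyIn W u →
    (∃ c : ℝ, c < r ∧ ∀ᶠ n in Filter.atTop, lengthEDistIn W x (u n) ≤ ENNReal.ofReal c) →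
    ∃ w ∈ interior W, ConvergesIn W u w}

/-- A domain in a space: a connected subset whose topological interior has the same
closure as the set itself. -/
def IsDomainIn {X : Type*} [TopologicalSpace X] (W : Set X) : Prop :=
  IsConnected W ∧ closure (interior W) = closure W

/-- `W` is an `(s(t), t₀)`-undistorted domain: for every `0 < t ≤ t₀` the closure in
`(W, d_W)` of the `s(t)`-neighborhood of the `t`-interior `W_t°` contains all of `W`. -/
def UndistortedDomain {X : Type*} [MetricSpace X] (W : Set X) (s : ℝ → ℝ) (t₀ : ℝ) : Prop :=
  ∀ t : ℝ, 0 < t → t ≤ t₀ →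
    ∀ x ∈ W, ∀ ε : ℝ, 0 < ε → ∃ y ∈ W,
      lengthEDistIn W x y < ENNReal.ofReal ε ∧
      ∃ z ∈ IntrinsicInterior W t, lengthEDistIn W y z < ENNReal.ofReal (s t)

/-- The measure `μ` is `(r₀, A₀)`-doubling along `W`: the doubling condition holds for
all balls of radius `≤ r₀` centered in the open `r₀`-neighborhood of `W`. -/
def DoublingAlong {X : Type*} [MetricSpace X] [MeasurableSpace X]
    (μ : Measure X) (W : Set X) (r₀ : ℝ) (A₀ : ℝ≥0) : Prop :=
  ∀ x : X, (∃ w ∈ W, dist x w < r₀) → ∀ r : ℝ, 0 < r → r ≤ r₀ →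
    0 < μ (Metric.ball x r) ∧
    μ (Metric.ball x r) ≤ (A₀ : ℝ≥0∞) * μ (Metric.ball x (r / 2)) ∧
    (A₀ : ℝ≥0∞) * μ (Metric.ball x (r / 2)) < ⊤


theorem edist_le_lengthEDistIn {X : Type*} [PseudoEMetricSpace X] (S : Set X) (x y : X) :
    edist x y ≤ lengthEDistIn S x y := by
  unfold lengthEDistIn
  refine le_iInf fun γ => le_iInf fun _ => le_iInf fun h0 => le_iInf fun h1 => le_iInf fun _ => ?_
  rw [← h0, ← h1]
  exact eVariationOn.edist_le _ (by simp) (by simp)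

theorem lengthEDistIn_le {X : Type*} [PseudoEMetricSpace X] {S : Set X} {γ : ℝ → X}
    (hc : ContinuousOn γ (Icc 0 1)) (hm : MapsTo γ (Icc 0 1) S) :
    lengthEDistIn S (γ 0) (γ 1) ≤ eVariationOn γ (Icc 0 1) := by
  unfold lengthEDistIn
  exact iInf_le_of_le γ (iInf_le_of_le hc (iInf_le_of_le rfl (iInf_le_of_le rfl
    (iInf_le_of_le hm le_rfl))))

theorem lengthEDistIn_le_sub {X : Type*} [PseudoEMetricSpace X] {S : Set X} {γ : ℝ → X} {a b : ℝ}
    (hab : a ≤ b) (hc : ContinuousOn γ (Icc a b)) (hm : MapsTo γ (Icc a b) S) :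
    lengthEDistIn S (γ a) (γ b) ≤ eVariationOn γ (Icc a b) := by
  have hφ : MapsTo (fun s : ℝ => a + s * (b - a)) (Icc 0 1) (Icc a b) := by
    intro s hs
    constructor <;> simp only <;> nlinarith [hs.1, hs.2]
  have hmono : MonotoneOn (fun s : ℝ => a + s * (b - a)) (Icc 0 1) := by
    intro s _ s' _ h
    simp only
    nlinarith
  have := lengthEDistIn_le (S := S) (γ := γ ∘ fun s : ℝ => a + s * (b - a))
    (hc.comp (by fun_prop) hφ) (hm.comp hφ)
  simp only [Function.comp, zero_mul, add_zero, one_mul, add_sub_cancel] at this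
  exact this.trans (eVariationOn.comp_le_of_monotoneOn γ _ hmono hφ)

theorem lengthEDistIn_le_sub' {X : Type*} [PseudoEMetricSpace X] {S : Set X} {γ : ℝ → X} {a b : ℝ}
    (hab : a ≤ b) (hc : ContinuousOn γ (Icc a b)) (hm : MapsTo γ (Icc a b) S) :
    lengthEDistIn S (γ b) (γ a) ≤ eVariationOn γ (Icc a b) := by
  have hφ : MapsTo (fun s : ℝ => b + s * (a - b)) (Icc 0 1) (Icc a b) := by
    intro s hs
    constructor <;> simp only <;> nlinarith [hs.1, hs.2]
  have hmono : AntitoneOn (fun s : ℝ => b + s * (a - b)) (Icc 0 1) := by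
    intro s _ s' _ h
    simp only
    nlinarith
  have := lengthEDistIn_le (S := S) (γ := γ ∘ fun s : ℝ => b + s * (a - b))
    (hc.comp (by fun_prop) hφ) (hm.comp hφ)
  simp only [Function.comp, zero_mul, add_zero, one_mul, add_sub_cancel] at this
  exact this.trans (eVariationOn.comp_le_of_antitoneOn γ _ hmono hφ)

theorem lengthEDistIn_lt_iff {X : Type*} [PseudoEMetricSpace X] {S : Set X} {x y : X} {c : ℝ≥0∞} :
    lengthEDistIn S x y < c ↔ ∃ γ : ℝ → X, ContinuousOn γ (Icc 0 1) ∧ γ 0 = x ∧ γ 1 = y ∧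
      MapsTo γ (Icc 0 1) S ∧ eVariationOn γ (Icc 0 1) < c := by
  unfold lengthEDistIn
  simp only [iInf_lt_iff, exists_prop]

theorem lengthEDistIn_triangle_lt {X : Type*} [PseudoEMetricSpace X] {S : Set X} {x y z : X}
    {c d : ℝ≥0∞} (h1 : lengthEDistIn S x y < c) (h2 : lengthEDistIn S y z < d) :
    lengthEDistIn S x z < c + d := by
  obtain ⟨f, fc, f0, f1, fm, fv⟩ := lengthEDistIn_lt_iff.1 h1
  obtain ⟨g, gc, g0, g1, gm, gv⟩ := lengthEDistIn_lt_iff.1 h2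
  let h : ℝ → X := fun s => if s ≤ 1 then f s else g (s - 1)
  have e1 : EqOn h f (Icc 0 1) := fun s hs => by simp [h, hs.2]
  have e2 : EqOn h (g ∘ fun s => s - 1) (Icc 1 2) := fun s hs => by
    rcases eq_or_lt_of_le hs.1 with h' | h'
    · subst h'; simp [h, f1, g0]
    · simp [h, not_le.2 h']
  have m2 : MapsTo (fun s : ℝ => s - 1) (Icc 1 2) (Icc 0 1) := fun s hs => by
    constructor <;> simp only <;> linarith [hs.1, hs.2]
  have hU : Icc (0:ℝ) 2 = Icc 0 1 ∪ Icc 1 2 :=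
    (Icc_union_Icc_eq_Icc (by norm_num) (by norm_num)).symm
  have hc : ContinuousOn h (Icc 0 2) := by
    rw [hU]
    exact (fc.congr e1).union_of_isClosed ((gc.comp (by fun_prop) m2).congr e2)
      isClosed_Icc isClosed_Icc
  have hm : MapsTo h (Icc 0 2) S := by
    rw [hU]
    exact (fm.congr e1.symm).union ((gm.comp m2).congr e2.symm)
  have key := lengthEDistIn_le_sub (by norm_num) hc hm
  have hv : eVariationOn h (Icc 0 2) = eVariationOn h (Icc 0 1) + eVariationOn h (Icc 1 2) := by
    have := eVariationOn.Icc_add_Icc h (s := univ) (a := (0:ℝ)) (b := 1) (c := 2) (by norm_num)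
      (by norm_num) (mem_univ _)
    simpa using this.symm
  have h0 : h 0 = x := by simp [h, f0]
  have h2 : h 2 = z := by
    have : ((2:ℝ) - 1) = 1 := by norm_num
    simp [h, this, g1]
  rw [h0, h2, hv, eVariationOn.eq_of_eqOn e1, eVariationOn.eq_of_eqOn e2] at key
  refine key.trans_lt (ENNReal.add_lt_add fv (lt_of_le_of_lt ?_ gv))
  exact eVariationOn.comp_le_of_monotoneOn g _ (fun a _ b _ hab => by simpa using hab) m2

theorem convergesIn_eq {X : Type*} [MetricSpace X] {W : Set X} {u : ℕ → X} {w p : X}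
    (h : ConvergesIn W u w) (hp : Tendsto u atTop (nhds p)) : w = p := by
  have : Tendsto u atTop (nhds w) := by
    rw [tendsto_iff_edist_tendsto_0]
    exact tendsto_of_tendsto_of_tendsto_of_le_of_le tendsto_const_nhds h (fun _ => zero_le)
      (fun n => edist_le_lengthEDistIn W _ _)
  exact tendsto_nhds_unique this hp

theorem lengthEDistIn_self {X : Type*} [MetricSpace X] {W : Set X} {z : X} (hz : z ∈ W) :
    lengthEDistIn W z z = 0 := by
  have := lengthEDistIn_le_sub (S := W) (γ := fun _ : ℝ => z) (le_refl (0:ℝ))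
    (by fun_prop) (fun _ _ => hz)
  simpa [eVariationOn.subsingleton] using this

theorem path_in_interior {X : Type*} [MetricSpace X] {W : Set X} {t : ℝ} (ht : 0 < t) {z : X}
    (hz : z ∈ IntrinsicInterior W t) {γ : ℝ → X} (hc : ContinuousOn γ (Icc 0 1)) (h0 : γ 0 = z)
    (hv : eVariationOn γ (Icc 0 1) < ENNReal.ofReal t) : MapsTo γ (Icc 0 1) (interior W) := by
  obtain ⟨hzW, R, htR, hR⟩ := hz
  have hz' : z ∈ interior W := by
    obtain ⟨w, hw, hcv⟩ := hR (fun _ => z) (fun _ => hzW)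
      (fun ε hε => ⟨0, fun m _ n _ => by rwa [lengthEDistIn_self hzW]⟩)
      ⟨0, ht.trans htR, Eventually.of_forall fun n => by simp [lengthEDistIn_self hzW]⟩
    rwa [← convergesIn_eq hcv tendsto_const_nhds]
  by_contra hcon
  have hne : (Icc 0 1 ∩ γ ⁻¹' (interior W)ᶜ).Nonempty := by
    simp only [MapsTo, not_forall] at hcon
    obtain ⟨s, hs, hs'⟩ := hcon
    exact ⟨s, hs, hs'⟩
  have hcl : IsClosed (Icc 0 1 ∩ γ ⁻¹' (interior W)ᶜ) :=
    hc.preimage_isClosed_of_isClosed isClosed_Icc isOpen_interior.isClosed_compl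
  obtain ⟨T, ⟨hT, hTn⟩, hTl⟩ :=
    (isCompact_Icc.of_isClosed_subset hcl inter_subset_left).exists_isLeast hne
  have hlt : ∀ s, 0 ≤ s → s < T → γ s ∈ interior W := by
    intro s hs hsT
    by_contra hn
    exact absurd (hTl ⟨⟨hs, hsT.le.trans hT.2⟩, hn⟩) (not_le.2 hsT)
  have hTpos : 0 < T := by
    rcases eq_or_lt_of_le hT.1 with h | h
    · exfalso; apply hTn; rw [← h, h0]; exact hz'
    · exact h
  let σ : ℕ → ℝ := fun n => T - T / (n + 1)
  have hσ0 : ∀ n, 0 ≤ σ n := fun n => by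
    have : T / (n + 1) ≤ T := div_le_self hTpos.le (by linarith [n.cast_nonneg (α := ℝ)])
    simp only [σ]; linarith
  have hσT : ∀ n, σ n < T := fun n => by
    have : 0 < T / (n + 1) := by positivity
    simp only [σ]; linarith
  have hσm : Monotone σ := fun m n hmn => by
    simp only [σ]
    gcongr
  have hσl : Tendsto σ atTop (nhds T) := by
    have := tendsto_one_div_add_atTop_nhds_zero_nat (𝕜 := ℝ)
    have := (this.const_mul T).const_sub T
    simpa [σ, div_eq_mul_inv] using this
  have hsub : ∀ a b, 0 ≤ a → b < T → MapsTo γ (Icc a b) W := fun a b ha hb s hs =>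
    interior_subset (hlt s (ha.trans hs.1) (hs.2.trans_lt hb))
  have hcs : ∀ a b, 0 ≤ a → b < T → ContinuousOn γ (Icc a b) := fun a b ha hb =>
    hc.mono (Icc_subset_Icc ha (hb.le.trans hT.2))
  let V : ℕ → ℝ≥0∞ := fun n => eVariationOn γ (Icc 0 (σ n))
  have hVle : ∀ n, V n ≤ eVariationOn γ (Icc 0 1) := fun n =>
    eVariationOn.mono _ (Icc_subset_Icc le_rfl ((hσT n).le.trans hT.2))
  have hVm : Monotone V := fun m n hmn => eVariationOn.mono _ (Icc_subset_Icc le_rfl (hσm hmn))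
  have hLtop : eVariationOn γ (Icc 0 1) ≠ ⊤ := (hv.trans ENNReal.ofReal_lt_top).ne
  have hVtop : ∀ n, V n ≠ ⊤ := fun n => ((hVle n).trans_lt hLtop.lt_top).ne
  have hadd : ∀ m n, m ≤ n → V m + eVariationOn γ (Icc (σ m) (σ n)) = V n := by
    intro m n hmn
    have := eVariationOn.Icc_add_Icc γ (s := univ) (hσ0 m) (hσm hmn) (mem_univ _)
    simpa using this
  have hVc : Tendsto V atTop (nhds (⨆ n, V n)) := tendsto_atTop_iSup hVm
  have hStop : (⨆ n, V n) ≠ ⊤ := ((iSup_le hVle).trans_lt hLtop.lt_top).ne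
  have hCau : IsCauchyIn W (fun n => γ (σ n)) := by
    intro ε hε
    have hev : ∃ N, (⨆ n, V n) < V N + ε := by
      by_cases hS : (⨆ n, V n) = 0
      · exact ⟨0, by rw [hS]; exact lt_of_lt_of_le hε le_add_self⟩
      · have : (⨆ n, V n) - ε < ⨆ n, V n := ENNReal.sub_lt_self hStop hS hε.ne'
        obtain ⟨N, hN⟩ := lt_iSup_iff.1 this
        exact ⟨N, ENNReal.lt_add_of_sub_lt_right (Or.inl hStop) hN⟩
    obtain ⟨N, hN⟩ := hev
    have hsm : ∀ m n, N ≤ m → m ≤ n → eVariationOn γ (Icc (σ m) (σ n)) < ε := by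
      intro m n hm hmn
      have h1 : V m + eVariationOn γ (Icc (σ m) (σ n)) < V m + ε := by
        rw [hadd m n hmn]
        exact (le_iSup V n).trans_lt (hN.trans_le (by gcongr; exact hVm hm))
      exact (ENNReal.add_lt_add_iff_left (hVtop m)).1 h1
    refine ⟨N, fun m hm n hn => ?_⟩
    rcases le_total m n with h | h
    · exact (lengthEDistIn_le_sub (hσm h) (hcs _ _ (hσ0 m) (hσT n))
        (hsub _ _ (hσ0 m) (hσT n))).trans_lt (hsm m n hm h)
    · exact (lengthEDistIn_le_sub' (hσm h) (hcs _ _ (hσ0 n) (hσT m))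
        (hsub _ _ (hσ0 n) (hσT m))).trans_lt (hsm n m hn h)
  obtain ⟨w, hw, hcv⟩ := hR (fun n => γ (σ n))
    (fun n => interior_subset (hlt _ (hσ0 n) (hσT n))) hCau
    ⟨t, htR, Eventually.of_forall fun n => by
      have := lengthEDistIn_le_sub (hσ0 n) (hcs _ _ le_rfl (hσT n)) (hsub _ _ le_rfl (hσT n))
      rw [h0] at this
      exact this.trans ((hVle n).trans hv.le)⟩
  have hlim : Tendsto (fun n => γ (σ n)) atTop (nhds (γ T)) := by
    have h1 := hc T hT
    refine h1.tendsto.comp (tendsto_nhdsWithin_iff.2 ⟨hσl, Eventually.of_forall fun n =>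
      ⟨hσ0 n, (hσT n).le.trans hT.2⟩⟩)
  rw [convergesIn_eq hcv hlim] at hw
  exact hTn hw

theorem doubling_iter {X : Type*} [MetricSpace X] [MeasurableSpace X]
    {μ : Measure X} {W : Set X} {r₀ : ℝ} {A₀ : ℝ≥0} (h : DoublingAlong μ W r₀ A₀)
    {z : X} (hz : ∃ w ∈ W, dist z w < r₀) {R : ℝ} (hR : 0 < R) (hR0 : R ≤ r₀) (k : ℕ) :
    μ (ball z R) ≤ (A₀ : ℝ≥0∞) ^ k * μ (ball z (R / 2 ^ k)) := by
  induction k with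
  | zero => simp
  | succ k ih =>
    have h1 : R / 2 ^ k ≤ r₀ := (div_le_self hR.le (one_le_pow₀ (by norm_num))).trans hR0
    have := (h z hz (R / 2 ^ k) (by positivity) h1).2.1
    refine ih.trans ?_
    rw [pow_succ, mul_assoc, pow_succ, ← div_div]
    gcongr

/-- The key local doubling step in the proof of the paper's Theorem 2: an undistorted
domain of `τ`-Lipschitz type with width `≥ t₀` is `(ρ, A')`-locally doubling in its
induced length metric, where `ρ` depends only on `r₀, t₀, τ` and `A'` only on `A₀, τ`. -/
theorem lipschitz_type_locally_doubling :
    ∃ ρfun : ℝ → ℝ → ℝ → ℝ, ∃ Afun : ℝ≥0 → ℝ → ℝ≥0,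
      (∀ r₀ t₀ τ : ℝ, 0 < r₀ → 0 < t₀ → 1 ≤ τ → 0 < ρfun r₀ t₀ τ) ∧
      (∀ (A₀ : ℝ≥0) (τ : ℝ), 1 ≤ A₀ → 1 ≤ τ → 1 ≤ Afun A₀ τ) ∧
      ∀ (τ r₀ t₀ : ℝ) (A₀ : ℝ≥0), 1 ≤ τ → 0 < r₀ → 0 < t₀ → 1 ≤ A₀ →
      ∀ (X : Type) [MetricSpace X] [MeasurableSpace X] [BorelSpace X]
        (μ : Measure X) (W : Set X),
        IsLengthSpace X → IsDomainIn W →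
        UndistortedDomain W (fun t => τ * t) t₀ →
        IsComplete (closure {z : X | ∃ w ∈ W, dist z w < r₀}) →
        DoublingAlong μ W r₀ A₀ →
        ∀ x ∈ W, ∀ r : ℝ, 0 < r → r ≤ ρfun r₀ t₀ τ →
          0 < μ {y ∈ W | lengthEDistIn W x y < ENNReal.ofReal r} ∧
          μ {y ∈ W | lengthEDistIn W x y < ENNReal.ofReal r} ≤
            (Afun A₀ τ : ℝ≥0∞) * μ {y ∈ W | lengthEDistIn W x y < ENNReal.ofReal (r / 2)} ∧
          (Afun A₀ τ : ℝ≥0∞) * μ {y ∈ W | lengthEDistIn W x y < ENNReal.ofReal (r / 2)} < ⊤ := by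
  refine ⟨fun r₀ t₀ _ => min (r₀ / 2) t₀, fun A₀ τ => A₀ ^ ⌈16 * τ⌉₊, ?_, ?_, ?_⟩
  · intro r₀ t₀ τ h1 h2 _
    exact lt_min (by linarith) h2
  · intro A₀ τ h _
    exact one_le_pow₀ h
  intro τ r₀ t₀ A₀ hτ hr₀ ht₀ hA X _ _ _ μ W hX hW hU _ hD x hx r hr hrρ
  have hr1 : r ≤ r₀ / 2 := hrρ.trans (min_le_left _ _)
  have hr2 : r ≤ t₀ := hrρ.trans (min_le_right _ _)
  have hτ0 : 0 < τ := by linarith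
  set t : ℝ := r / (8 * τ) with htdef
  have ht : 0 < t := by positivity
  have htr : t ≤ r / 8 := by
    rw [htdef]
    gcongr
    linarith
  have hτt : τ * t = r / 8 := by
    rw [htdef]
    field_simp
  obtain ⟨y, hy, hxy, z, hz, hyz⟩ := hU t ht (by linarith) x hx (r / 8) (by positivity)
  simp only [hτt] at hyz
  have hzW : z ∈ W := hz.1
  have hxz : lengthEDistIn W x z < ENNReal.ofReal (r / 4) := by
    have := lengthEDistIn_triangle_lt hxy hyz
    rwa [← ENNReal.ofReal_add (by positivity) (by positivity),
      show r / 8 + r / 8 = r / 4 by ring] at this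
  have hball : ∀ s, r / 2 ≤ s →
      ball z t ⊆ {y ∈ W | lengthEDistIn W x y < ENNReal.ofReal s} := by
    intro s hs p hp
    have h1 : edist z p < ENNReal.ofReal t := by
      rw [edist_dist, dist_comm]
      exact (ENNReal.ofReal_lt_ofReal_iff ht).2 hp
    rw [hX z p] at h1
    obtain ⟨γ, gc, g0, g1, -, gv⟩ := lengthEDistIn_lt_iff.1 h1
    have hm : MapsTo γ (Icc 0 1) W :=
      (path_in_interior ht hz gc g0 gv).mono_right interior_subset
    have hzp : lengthEDistIn W z p < ENNReal.ofReal t :=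
      lengthEDistIn_lt_iff.2 ⟨γ, gc, g0, g1, hm, gv⟩
    refine ⟨g1 ▸ hm (by simp), ?_⟩
    have := lengthEDistIn_triangle_lt hxz hzp
    rw [← ENNReal.ofReal_add (by positivity) ht.le] at this
    exact this.trans_le (ENNReal.ofReal_le_ofReal (by linarith))
  have hsub : ∀ s, {y ∈ W | lengthEDistIn W x y < ENNReal.ofReal s} ⊆ ball x s := by
    intro s p hp
    have h1 : edist x p < ENNReal.ofReal s := (edist_le_lengthEDistIn W x p).trans_lt hp.2
    rw [edist_dist, ENNReal.ofReal_lt_ofReal_iff_of_nonneg dist_nonneg, dist_comm] at h1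
    exact h1
  have hzn : ∃ w ∈ W, dist z w < r₀ := ⟨z, hzW, by simpa using hr₀⟩
  have hxn : ∃ w ∈ W, dist x w < r₀ := ⟨x, hx, by simpa using hr₀⟩
  have hdxz : dist x z < r := by
    have h1 := (edist_le_lengthEDistIn W x z).trans_lt hxz
    rw [edist_dist, ENNReal.ofReal_lt_ofReal_iff_of_nonneg dist_nonneg] at h1
    linarith
  refine ⟨?_, ?_, ?_⟩
  · exact (hD z hzn t ht (by linarith)).1.trans_le (measure_mono (hball r (by linarith)))
  · have hk : 16 * τ ≤ 2 ^ ⌈16 * τ⌉₊ := by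
      refine (Nat.le_ceil _).trans ?_
      exact_mod_cast (Nat.lt_two_pow_self).le
    have hkt : 2 * r / 2 ^ ⌈16 * τ⌉₊ ≤ t := by
      rw [htdef, div_le_div_iff₀ (by positivity) (by positivity)]
      nlinarith
    calc _ ≤ μ (ball x r) := measure_mono (hsub r)
      _ ≤ μ (ball z (2 * r)) := measure_mono (ball_subset_ball' (by linarith))
      _ ≤ (A₀ : ℝ≥0∞) ^ ⌈16 * τ⌉₊ * μ (ball z (2 * r / 2 ^ ⌈16 * τ⌉₊)) :=
        doubling_iter hD hzn (by linarith) (by linarith) _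
      _ ≤ _ := by
        push_cast
        gcongr
        exact (ball_subset_ball hkt).trans (hball _ le_rfl)
  · refine ENNReal.mul_lt_top ENNReal.coe_lt_top ?_
    refine (measure_mono (hsub (r / 2))).trans_lt ?_
    refine lt_of_le_of_lt ?_ (hD x hxn r hr (by linarith)).2.2
    exact le_mul_of_one_le_left zero_le (by exact_mod_cast hA)
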